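/- arXiv:2106.00164 — 6 statements merged into one kernel-verified Lean document; each statement's English description precedes it below -/
import Mathlib

section
/- Let (Ω, F, P) be a probability space, let Θ ⊆ ℝ be a convex set with θ0 an interior point, and let M : Ω → ℝ → ℝ be such that for every ω ∈ Ω the map θ ↦ M(ω, θ) is convex on Θ and differentiable at θ0. Let θ̂ : Ω → ℝ be a measurable map such that for every ω, θ̂(ω) minimizes M(ω, ·) over Θ, and assume ω ↦ Ṁ(ω, θ0) is measurable, where Ṁ(ω, θ0) denotes the derivative of M(ω, ·) at θ0. Then Med-bias_{θ0}(θ̂) ≤ max(1/2 − max{P(Ṁ(θ0) < 0), P(Ṁ(θ0) > 0)}, 0). -/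
open MeasureTheory

/-- The median bias of an estimator `θhat` for a target `θ0` under the probability
measure `μ`: `Med-bias = max (1/2 - max {P(θhat ≤ θ0), P(θhat ≥ θ0)}) 0`. -/
noncomputable def medBias {Ω : Type*} [MeasurableSpace Ω] (μ : Measure Ω)
    (θhat : Ω → ℝ) (θ0 : ℝ) : ℝ :=
  max (1 / 2 - max (μ {ω | θhat ω ≤ θ0}).toReal (μ {ω | θhat ω ≥ θ0}).toReal) 0

/-- A minimizer of a convex function lies to the right of any point with negative derivative. -/
theorem ConvexOn.le_of_hasDerivAt_neg_of_isMinOn {S : Set ℝ} {f : ℝ → ℝ} {f' x y : ℝ}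
    (hf : ConvexOn ℝ S f) (hx : x ∈ S) (hy : y ∈ S) (hmin : IsMinOn f S y)
    (hderiv : HasDerivAt f f' x) (hneg : f' < 0) : x ≤ y := by
  by_contra! hyx
  have hslope := (hf.slope_le_of_hasDerivAt hy hx hyx hderiv).trans_lt hneg
  rw [slope_def_field] at hslope
  exact hslope.not_ge (div_nonneg (sub_nonneg.2 (hmin hx)) (sub_pos.2 hyx).le)

/-- A minimizer of a convex function lies to the left of any point with positive derivative. -/
theorem ConvexOn.le_of_hasDerivAt_pos_of_isMinOn {S : Set ℝ} {f : ℝ → ℝ} {f' x y : ℝ}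
    (hf : ConvexOn ℝ S f) (hx : x ∈ S) (hy : y ∈ S) (hmin : IsMinOn f S y)
    (hderiv : HasDerivAt f f' x) (hpos : 0 < f') : y ≤ x := by
  by_contra! hxy
  have hslope := hpos.trans_le (hf.le_slope_of_hasDerivAt hx hy hxy hderiv)
  rw [slope_def_field] at hslope
  exact hslope.not_ge
    (div_nonpos_of_nonpos_of_nonneg (sub_nonpos.2 (hmin hx)) (sub_pos.2 hxy).le)

/-- For a random convex objective `M` on a convex set `Θ ⊆ ℝ` with interior
point `θ0`, differentiable at `θ0` with derivative `M'`, and a measurable minimizer `θhat`,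
the median bias of `θhat` is at most
`max (1/2 - max {P(M'(θ0) < 0), P(M'(θ0) > 0)}) 0`. -/
theorem median_bias_stmt3 {Ω : Type*} [MeasurableSpace Ω] (μ : Measure Ω)
    [IsProbabilityMeasure μ]
    (Θ : Set ℝ) (hΘ : Convex ℝ Θ) (θ0 : ℝ) (hθ0 : θ0 ∈ interior Θ)
    (M : Ω → ℝ → ℝ) (M' : Ω → ℝ)
    (hconv : ∀ ω, ConvexOn ℝ Θ (M ω))
    (hderiv : ∀ ω, HasDerivAt (M ω) (M' ω) θ0)
    (hM'meas : Measurable M')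
    (θhat : Ω → ℝ) (hθhatmeas : Measurable θhat)
    (hmem : ∀ ω, θhat ω ∈ Θ) (hmin : ∀ ω, ∀ θ ∈ Θ, M ω (θhat ω) ≤ M ω θ) :
    medBias μ θhat θ0 ≤
      max (1 / 2 - max (μ {ω | M' ω < 0}).toReal (μ {ω | M' ω > 0}).toReal) 0 := by
  have hθ0' : θ0 ∈ Θ := interior_subset hθ0
  have hneg : μ.real {ω | M' ω < 0} ≤ μ.real {ω | θhat ω ≥ θ0} :=
    measureReal_mono fun ω hω ↦
      (hconv ω).le_of_hasDerivAt_neg_of_isMinOn hθ0' (hmem ω) (hmin ω) (hderiv ω) hω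
  have hpos : μ.real {ω | M' ω > 0} ≤ μ.real {ω | θhat ω ≤ θ0} :=
    measureReal_mono fun ω hω ↦
      (hconv ω).le_of_hasDerivAt_pos_of_isMinOn hθ0' (hmem ω) (hmin ω) (hderiv ω) hω
  rw [medBias, max_comm (μ {ω | θhat ω ≤ θ0}).toReal]
  exact max_le_max_right 0 (sub_le_sub_left (max_le_max hneg hpos) _)
end

section
/- Let (Ω, F, P) be a probability space, let Θ ⊆ ℝ be a convex set, let θ0 ∈ Θ and ε > 0 with θ0 + ε ∈ Θ and θ0 − ε ∈ Θ, and let M : Ω → ℝ → ℝ be such that for every ω the map θ ↦ M(ω, θ) is convex on Θ. Let θ̂ : Ω → ℝ be a measurable map such that for every ω, θ̂(ω) minimizes M(ω, ·) over Θ, and assume ω ↦ M(ω, θ) is measurable for each fixed θ. Then P(θ̂ ≤ θ0 + ε) ≥ P(M(θ0) < M(θ0 + ε)) and P(θ̂ ≥ θ0 − ε) ≥ P(M(θ0) < M(θ0 − ε)). -/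
open MeasureTheory

/-- For a random objective `M` that is convex on a convex set `Θ ⊆ ℝ` for every
`ω`, with `θ0, θ0 + ε, θ0 - ε ∈ Θ` and `ε > 0`, and a measurable minimizer `θhat` of
`M(ω, ·)` over `Θ`, we have `P(θhat ≤ θ0 + ε) ≥ P(M(θ0) < M(θ0 + ε))` and
`P(θhat ≥ θ0 - ε) ≥ P(M(θ0) < M(θ0 - ε))`. -/
theorem median_bias_stmt5 {Ω : Type*} [MeasurableSpace Ω] (μ : Measure Ω)
    [IsProbabilityMeasure μ]
    (Θ : Set ℝ) (hΘ : Convex ℝ Θ) (θ0 ε : ℝ) (hε : 0 < ε)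
    (hθ0 : θ0 ∈ Θ) (hθ0p : θ0 + ε ∈ Θ) (hθ0m : θ0 - ε ∈ Θ)
    (M : Ω → ℝ → ℝ) (hconv : ∀ ω, ConvexOn ℝ Θ (M ω))
    (hMmeas : ∀ θ : ℝ, Measurable (fun ω => M ω θ))
    (θhat : Ω → ℝ) (hθhatmeas : Measurable θhat)
    (hmem : ∀ ω, θhat ω ∈ Θ) (hmin : ∀ ω, ∀ θ ∈ Θ, M ω (θhat ω) ≤ M ω θ) :
    μ {ω | M ω θ0 < M ω (θ0 + ε)} ≤ μ {ω | θhat ω ≤ θ0 + ε} ∧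
      μ {ω | M ω θ0 < M ω (θ0 - ε)} ≤ μ {ω | θhat ω ≥ θ0 - ε} := by
  constructor
  · refine measure_mono fun ω (hω : M ω θ0 < M ω (θ0 + ε)) => ?_
    by_contra h
    have hlt : θ0 + ε < θhat ω := not_le.mp h
    have hseg : θ0 + ε ∈ openSegment ℝ θ0 (θhat ω) := by
      rw [openSegment_eq_Ioo (by linarith)]
      exact ⟨by linarith, hlt⟩
    exact ((hconv ω).lt_right_of_left_lt hθ0 (hmem ω) hseg hω).not_ge (hmin ω _ hθ0p)
  · refine measure_mono fun ω (hω : M ω θ0 < M ω (θ0 - ε)) => ?_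
    by_contra h
    have hlt : θhat ω < θ0 - ε := not_le.mp h
    have hseg : θ0 - ε ∈ openSegment ℝ (θhat ω) θ0 := by
      rw [openSegment_eq_Ioo (by linarith)]
      exact ⟨hlt, by linarith⟩
    exact ((hconv ω).lt_left_of_right_lt (hmem ω) hθ0 hseg hω).not_ge (hmin ω _ hθ0m)
end

section
/- Let (Ω, F, P) be a probability space, let Θ ⊆ ℝ be a convex set, let θ0 be an interior point of Θ, and let M : Ω → ℝ → ℝ be such that for every ω the map θ ↦ M(ω, θ) is convex on Θ, with ω ↦ M(ω, θ) measurable for each fixed θ. Let θ̂ : Ω → ℝ be a measurable map such that for every ω, θ̂(ω) minimizes M(ω, ·) over Θ. Then Med-bias_{θ0}(θ̂) ≤ max(1/2 − max{ inf_{ε > 0, θ0+ε ∈ Θ} P(M(θ0) < M(θ0 + ε)), inf_{ε > 0, θ0−ε ∈ Θ} P(M(θ0) < M(θ0 − ε)) }, 0). -/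
open MeasureTheory

/-- If each event `A ε` forces `X ≤ ε`, then the infimum of the probabilities of the events
`A ε`, over a set of `ε` containing a right neighbourhood of `0`, is at most `P(X ≤ 0)`. -/
lemma iInf_measure_le_measure_nonpos {Ω : Type*} [MeasurableSpace Ω] (μ : Measure Ω)
    [IsFiniteMeasure μ] {X : Ω → ℝ} (hX : Measurable X) {p : ℝ → Prop}
    (hp : ∀ᶠ ε in nhdsWithin 0 (Set.Ioi 0), p ε) (A : ℝ → Set Ω)
    (hA : ∀ ε, p ε → A ε ⊆ {ω | X ω ≤ ε}) :
    ⨅ ε : {ε : ℝ // p ε}, (μ (A ε.1)).toReal ≤ (μ {ω | X ω ≤ 0}).toReal := by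
  have hlim := tendsto_measure_biInter_gt (μ := μ) (s := fun r : ℝ => {ω | X ω ≤ r}) (a := 0)
    (fun r _ => (measurableSet_le hX measurable_const).nullMeasurableSet)
    (fun i j _ hij ω (hω : X ω ≤ i) => hω.trans hij) ⟨1, one_pos, measure_ne_top _ _⟩
  have hinter : ⋂ r > (0 : ℝ), {ω | X ω ≤ r} = {ω | X ω ≤ 0} := by
    ext ω
    simp only [Set.mem_iInter, Set.mem_ofPred_eq]
    exact ⟨fun h => le_of_forall_gt_imp_ge_of_dense h, fun h r hr => h.trans hr.le⟩
  rw [hinter] at hlim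
  refine ge_of_tendsto ((ENNReal.tendsto_toReal (measure_ne_top _ _)).comp hlim) ?_
  filter_upwards [hp] with ε hε
  have hbdd : BddBelow (Set.range fun ε : {ε : ℝ // p ε} => (μ (A ε.1)).toReal) :=
    ⟨0, by rintro _ ⟨ε, rfl⟩; exact ENNReal.toReal_nonneg⟩
  exact (ciInf_le hbdd ⟨ε, hε⟩).trans
    (ENNReal.toReal_mono (measure_ne_top _ _) (measure_mono (hA ε hε)))

/-- For a random objective `M` that is convex on a convex set `Θ ⊆ ℝ` for
every `ω`, with `θ0` an interior point of `Θ`, and a measurable minimizer `θhat` of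
`M(ω, ·)` over `Θ`, the median bias of `θhat` is bounded by
`max (1/2 - max {inf_{ε>0, θ0+ε∈Θ} P(M(θ0) < M(θ0+ε)), inf_{ε>0, θ0-ε∈Θ} P(M(θ0) < M(θ0-ε))}) 0`. -/
theorem median_bias_stmt6 {Ω : Type*} [MeasurableSpace Ω] (μ : Measure Ω)
    [IsProbabilityMeasure μ]
    (Θ : Set ℝ) (hΘ : Convex ℝ Θ) (θ0 : ℝ) (hθ0 : θ0 ∈ interior Θ)
    (M : Ω → ℝ → ℝ) (hconv : ∀ ω, ConvexOn ℝ Θ (M ω))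
    (hMmeas : ∀ θ : ℝ, Measurable (fun ω => M ω θ))
    (θhat : Ω → ℝ) (hθhatmeas : Measurable θhat)
    (hmem : ∀ ω, θhat ω ∈ Θ) (hmin : ∀ ω, ∀ θ ∈ Θ, M ω (θhat ω) ≤ M ω θ) :
    medBias μ θhat θ0 ≤
      max (1 / 2 -
        max (⨅ ε : {ε : ℝ // 0 < ε ∧ θ0 + ε ∈ Θ},
              (μ {ω | M ω θ0 < M ω (θ0 + ε.1)}).toReal)
            (⨅ ε : {ε : ℝ // 0 < ε ∧ θ0 - ε ∈ Θ},
              (μ {ω | M ω θ0 < M ω (θ0 - ε.1)}).toReal)) 0 := by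
  have hnear : Θ ∈ nhds θ0 := mem_interior_iff_mem_nhds.mp hθ0
  have hθ0mem : θ0 ∈ Θ := interior_subset hθ0
  have hright : ∀ᶠ ε in nhdsWithin (0 : ℝ) (Set.Ioi 0), 0 < ε ∧ θ0 + ε ∈ Θ := by
    have h : Filter.Tendsto (fun ε : ℝ => θ0 + ε) (nhds 0) (nhds θ0) :=
      Continuous.tendsto' (by fun_prop) _ _ (by simp)
    exact Filter.Eventually.and self_mem_nhdsWithin (nhdsWithin_le_nhds (h hnear))
  have hleft : ∀ᶠ ε in nhdsWithin (0 : ℝ) (Set.Ioi 0), 0 < ε ∧ θ0 - ε ∈ Θ := by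
    have h : Filter.Tendsto (fun ε : ℝ => θ0 - ε) (nhds 0) (nhds θ0) :=
      Continuous.tendsto' (by fun_prop) _ _ (by simp)
    exact Filter.Eventually.and self_mem_nhdsWithin (nhdsWithin_le_nhds (h hnear))
  have hle := iInf_measure_le_measure_nonpos μ (hθhatmeas.sub_const θ0) hright
    (fun ε => {ω | M ω θ0 < M ω (θ0 + ε)}) (by
      intro ε hε ω hω
      by_contra! hlt
      simp only [Set.mem_ofPred_eq, not_le] at hω hlt
      have h := (hconv ω).le_max_of_mem_Icc hθ0mem (hmem ω)
        (z := θ0 + ε) ⟨by linarith, by linarith⟩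
      rw [max_eq_left (hmin ω θ0 hθ0mem)] at h
      exact hω.not_ge h)
  have hge := iInf_measure_le_measure_nonpos μ (hθhatmeas.const_sub θ0) hleft
    (fun ε => {ω | M ω θ0 < M ω (θ0 - ε)}) (by
      intro ε hε ω hω
      by_contra! hlt
      simp only [Set.mem_ofPred_eq, not_le] at hω hlt
      have h := (hconv ω).le_max_of_mem_Icc (hmem ω) hθ0mem
        (z := θ0 - ε) ⟨by linarith, by linarith⟩
      rw [max_eq_right (hmin ω θ0 hθ0mem)] at h
      exact hω.not_ge h)
  simp only [sub_nonpos] at hle hge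
  exact max_le_max_right _ (sub_le_sub_left (max_le_max hle hge) _)
end

section
/- Let (Ω, F, P) be a probability space, Θ ⊆ ℝ, θ0 ∈ ℝ, and let M : Ω → ℝ → ℝ be such that for every ω the map θ ↦ M(ω, θ) is differentiable at θ0, with ω ↦ Ṁ(ω, θ0) measurable. Let θ̂ : Ω → ℝ be a measurable map such that for every ω, θ̂(ω) minimizes M(ω, ·) over Θ. Fix δ > 0 with [θ0 − δ, θ0 + δ] ⊆ Θ, and define η1(δ) := 1 − P({ω : θ ↦ M(ω, θ) is convex on [θ0 − δ, θ0 + δ]}) and η2(δ) := P(|θ̂ − θ0| > δ), assuming the convexity event is measurable. Then Med-bias_{θ0}(θ̂) ≤ max(1/2 − max{P(Ṁ(θ0) < 0), P(Ṁ(θ0) > 0)}, 0) + η1(δ) + η2(δ). -/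
open MeasureTheory

theorem ConvexOn.le_of_hasDerivAt_neg {S : Set ℝ} {f : ℝ → ℝ} {f' x y : ℝ}
    (hf : ConvexOn ℝ S f) (hx : x ∈ S) (hy : y ∈ S) (hd : HasDerivAt f f' x) (hneg : f' < 0)
    (hle : f y ≤ f x) : x ≤ y := by
  by_contra! h
  have hs := hf.slope_le_of_hasDerivAt hy hx h hd
  rw [slope_def_field] at hs
  have : 0 ≤ (f x - f y) / (x - y) := div_nonneg (by linarith) (by linarith)
  linarith

theorem ConvexOn.le_of_hasDerivAt_pos {S : Set ℝ} {f : ℝ → ℝ} {f' x y : ℝ}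
    (hf : ConvexOn ℝ S f) (hx : x ∈ S) (hy : y ∈ S) (hd : HasDerivAt f f' x) (hpos : 0 < f')
    (hle : f y ≤ f x) : y ≤ x := by
  by_contra! h
  have hs := hf.le_slope_of_hasDerivAt hx hy h hd
  rw [slope_def_field] at hs
  have : (f y - f x) / (y - x) ≤ 0 := div_nonpos_of_nonpos_of_nonneg (by linarith) (by linarith)
  linarith

theorem MeasureTheory.toReal_le_add_one_sub_add {Ω : Type*} [MeasurableSpace Ω] (μ : Measure Ω)
    [IsProbabilityMeasure μ] {A B C D : Set Ω} (hC : MeasurableSet C)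
    (h : ∀ ω ∈ A, ω ∈ C → ω ∉ D → ω ∈ B) :
    (μ A).toReal ≤ (μ B).toReal + (1 - (μ C).toReal) + (μ D).toReal := by
  have hsub : A ⊆ B ∪ Cᶜ ∪ D := by
    intro ω hω
    by_cases hωC : ω ∈ C <;> by_cases hωD : ω ∈ D <;> simp [hωC, hωD, h ω hω]
  calc (μ A).toReal ≤ μ.real (B ∪ Cᶜ ∪ D) := measureReal_mono hsub
    _ ≤ μ.real (B ∪ Cᶜ) + μ.real D := measureReal_union_le _ _
    _ ≤ μ.real B + μ.real Cᶜ + μ.real D := by gcongr; exact measureReal_union_le _ _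
    _ = _ := by rw [probReal_compl_eq_one_sub hC]; rfl

/-- non-convex objectives: for a random objective `M` differentiable at `θ0`
with derivative `M'`, a measurable minimizer `θhat` of `M(ω, ·)` over `Θ`, and `δ > 0` with
`[θ0 - δ, θ0 + δ] ⊆ Θ`, setting
`η1 = 1 - P(θ ↦ M(ω, θ) is convex on [θ0 - δ, θ0 + δ])` and `η2 = P(|θhat - θ0| > δ)`,
the median bias of `θhat` is at most
`max (1/2 - max {P(M'(θ0) < 0), P(M'(θ0) > 0)}) 0 + η1 + η2`. -/
theorem median_bias_stmt7 {Ω : Type*} [MeasurableSpace Ω] (μ : Measure Ω)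
    [IsProbabilityMeasure μ]
    (Θ : Set ℝ) (θ0 : ℝ)
    (M : Ω → ℝ → ℝ) (M' : Ω → ℝ)
    (hderiv : ∀ ω, HasDerivAt (M ω) (M' ω) θ0)
    (hM'meas : Measurable M')
    (θhat : Ω → ℝ) (hθhatmeas : Measurable θhat)
    (hmem : ∀ ω, θhat ω ∈ Θ) (hmin : ∀ ω, ∀ θ ∈ Θ, M ω (θhat ω) ≤ M ω θ)
    (δ : ℝ) (hδ : 0 < δ) (hIcc : Set.Icc (θ0 - δ) (θ0 + δ) ⊆ Θ)
    (hconvmeas : MeasurableSet {ω | ConvexOn ℝ (Set.Icc (θ0 - δ) (θ0 + δ)) (M ω)}) :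
    medBias μ θhat θ0 ≤
      max (1 / 2 - max (μ {ω | M' ω < 0}).toReal (μ {ω | M' ω > 0}).toReal) 0 +
        (1 - (μ {ω | ConvexOn ℝ (Set.Icc (θ0 - δ) (θ0 + δ)) (M ω)}).toReal) +
        (μ {ω | δ < |θhat ω - θ0|}).toReal := by
  have hθ0 : θ0 ∈ Set.Icc (θ0 - δ) (θ0 + δ) := ⟨by linarith, by linarith⟩
  have hmemIcc : ∀ ω, ω ∉ {ω | δ < |θhat ω - θ0|} →
      θhat ω ∈ Set.Icc (θ0 - δ) (θ0 + δ) := fun ω h => by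
    obtain ⟨h₁, h₂⟩ := abs_le.mp (not_lt.mp (Set.notMem_ofPred_iff.mp h))
    exact ⟨by linarith, by linarith⟩
  have hneg := toReal_le_add_one_sub_add μ (A := {ω | M' ω < 0}) (B := {ω | θhat ω ≥ θ0})
    (D := {ω | δ < |θhat ω - θ0|}) hconvmeas fun ω hA hC hD =>
      hC.le_of_hasDerivAt_neg hθ0 (hmemIcc ω hD) (hderiv ω) hA (hmin ω θ0 (hIcc hθ0))
  have hpos := toReal_le_add_one_sub_add μ (A := {ω | M' ω > 0}) (B := {ω | θhat ω ≤ θ0})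
    (D := {ω | δ < |θhat ω - θ0|}) hconvmeas fun ω hA hC hD =>
      hC.le_of_hasDerivAt_pos hθ0 (hmemIcc ω hD) (hderiv ω) hA (hmin ω θ0 (hIcc hθ0))
  have hconv : (μ {ω | ConvexOn ℝ (Set.Icc (θ0 - δ) (θ0 + δ)) (M ω)}).toReal ≤ 1 :=
    measureReal_le_one
  have htail : 0 ≤ (μ {ω | δ < |θhat ω - θ0|}).toReal := ENNReal.toReal_nonneg
  have hmax : max (μ {ω | M' ω < 0}).toReal (μ {ω | M' ω > 0}).toReal ≤
      max (μ {ω | θhat ω ≤ θ0}).toReal (μ {ω | θhat ω ≥ θ0}).toReal +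
        (1 - (μ {ω | ConvexOn ℝ (Set.Icc (θ0 - δ) (θ0 + δ)) (M ω)}).toReal) +
        (μ {ω | δ < |θhat ω - θ0|}).toReal :=
    max_le (hneg.trans (by gcongr; exact le_max_right _ _))
      (hpos.trans (by gcongr; exact le_max_left _ _))
  refine max_le ?_ ?_
  · linarith [le_max_left (1 / 2 - max (μ {ω | M' ω < 0}).toReal (μ {ω | M' ω > 0}).toReal) 0]
  · linarith [le_max_right (1 / 2 - max (μ {ω | M' ω < 0}).toReal (μ {ω | M' ω > 0}).toReal) 0]
end

section
/- Let (Ω, F, P) be a probability space, θ0 ∈ ℝ, and let M : Ω → ℝ → ℝ be such that for every ω the map θ ↦ M(ω, θ) is twice continuously differentiable. Let θ̂ : Ω → ℝ be measurable with Ṁ(ω, θ̂(ω)) = 0 for almost every ω, assume ω ↦ Ṁ(ω, θ0) is measurable, and assume that for almost every ω the quantity J(ω) := ∫₀¹ M̈(ω, θ0 + t(θ̂(ω) − θ0)) dt is strictly positive. Then Med-bias_{θ0}(θ̂) = max(1/2 − max{P(Ṁ(θ0) ≥ 0), P(Ṁ(θ0) ≤ 0)}, 0). -/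
open MeasureTheory

/-- The fundamental theorem of calculus for a `C¹` function along the segment from `a` to `x`. -/
theorem sub_eq_mul_integral_deriv {g : ℝ → ℝ} (hg : ContDiff ℝ 1 g) (a x : ℝ) :
    g x - g a = (x - a) * ∫ t in (0:ℝ)..1, deriv g (a + t * (x - a)) := by
  have hcont : Continuous (deriv g) := hg.continuous_deriv le_rfl
  have hsubst := intervalIntegral.mul_integral_comp_add_mul
    (a := 0) (b := 1) (f := deriv g) (x - a) a
  have hftc := intervalIntegral.integral_deriv_eq_sub
    (fun y _ => hg.differentiable one_ne_zero y) (hcont.intervalIntegrable a x)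
  simp only [mul_zero, add_zero, mul_one, add_sub_cancel, hftc] at hsubst
  simp only [mul_comm _ (x - a)] at hsubst ⊢
  exact hsubst.symm

/-- If `x` is a root of `g` and the average of `g'` over the segment from `a` to `x` is positive,
then the sign of `g a` is that of `a - x`. -/
theorem root_le_iff_and_le_root_iff {g : ℝ → ℝ} (hg : ContDiff ℝ 1 g) {a x : ℝ} (hx : g x = 0)
    (hJ : 0 < ∫ t in (0:ℝ)..1, deriv g (a + t * (x - a))) :
    (x ≤ a ↔ 0 ≤ g a) ∧ (a ≤ x ↔ g a ≤ 0) := by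
  have hga : g a = (a - x) * ∫ t in (0:ℝ)..1, deriv g (a + t * (x - a)) := by
    linarith [sub_eq_mul_integral_deriv hg a x]
  rw [hga, mul_nonneg_iff_of_pos_right hJ, sub_nonneg, ← not_lt (a := 0),
    mul_pos_iff_of_pos_right hJ, sub_pos, not_lt]
  exact ⟨Iff.rfl, Iff.rfl⟩

/-- if for every `ω` the map `θ ↦ M(ω, θ)` is twice continuously
differentiable, `θhat` is a measurable a.e. root of the derivative, and the averaged
second derivative `J(ω) = ∫₀¹ M̈(ω, θ0 + t(θhat(ω) - θ0)) dt` is a.e. strictly positive,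
then `Med-bias_{θ0}(θhat) = max (1/2 - max {P(Ṁ(θ0) ≥ 0), P(Ṁ(θ0) ≤ 0)}) 0`. -/
theorem median_bias_stmt9 {Ω : Type*} [MeasurableSpace Ω] (μ : Measure Ω)
    [IsProbabilityMeasure μ] (θ0 : ℝ)
    (M : Ω → ℝ → ℝ) (hM : ∀ ω, ContDiff ℝ 2 (M ω))
    (θhat : Ω → ℝ) (hθhatmeas : Measurable θhat)
    (hroot : ∀ᵐ ω ∂μ, deriv (M ω) (θhat ω) = 0)
    (hM'meas : Measurable (fun ω => deriv (M ω) θ0))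
    (hJpos : ∀ᵐ ω ∂μ,
      0 < ∫ t in (0:ℝ)..1, deriv (deriv (M ω)) (θ0 + t * (θhat ω - θ0))) :
    medBias μ θhat θ0 =
      max (1 / 2 -
        max (μ {ω | deriv (M ω) θ0 ≥ 0}).toReal (μ {ω | deriv (M ω) θ0 ≤ 0}).toReal) 0 := by
  have hsign : ∀ᵐ ω ∂μ, (θhat ω ≤ θ0 ↔ 0 ≤ deriv (M ω) θ0) ∧
      (θ0 ≤ θhat ω ↔ deriv (M ω) θ0 ≤ 0) := by
    filter_upwards [hroot, hJpos] with ω hω hJ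
    have hC1 : ContDiff ℝ 1 (deriv (M ω)) :=
      ((contDiff_succ_iff_deriv (n := 1)).mp (by simpa [one_add_one_eq_two] using hM ω)).2.2
    exact root_le_iff_and_le_root_iff hC1 hω hJ
  have hle : μ {ω | θhat ω ≤ θ0} = μ {ω | deriv (M ω) θ0 ≥ 0} :=
    measure_congr (Filter.eventuallyEq_set.mpr (hsign.mono fun ω h => h.1))
  have hge : μ {ω | θhat ω ≥ θ0} = μ {ω | deriv (M ω) θ0 ≤ 0} :=
    measure_congr (Filter.eventuallyEq_set.mpr (hsign.mono fun ω h => h.2))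
  rw [medBias, hle, hge]
end

section
/- Let (Ω, F, P) be a probability space, n, d ∈ ℕ, and for i = 1, …, n let X_i (valued in ℝ^d) and Y_i, T_i (real-valued) be random variables. Let β̂_Y, β̂_T be ℝ^d-valued random vectors satisfying, almost surely, the normal equations ∑_{i=1}^n (Y_i − ⟨β̂_Y, X_i⟩) X_i = 0 and ∑_{i=1}^n (T_i − ⟨β̂_T, X_i⟩) X_i = 0, and define R̂_{Y,i} = Y_i − ⟨β̂_Y, X_i⟩ and R̂_{T,i} = T_i − ⟨β̂_T, X_i⟩. Assume ∑_{i=1}^n R̂_{T,i}² > 0 almost surely, and let θ̂ be a measurable map minimizing θ ↦ ∑_{i=1}^n (R̂_{Y,i} − θ R̂_{T,i})² over ℝ almost surely. Fix θ0 ∈ ℝ and β_Y, β_T ∈ ℝ^d, set R_{Y,i} = Y_i − ⟨β_Y, X_i⟩, R_{T,i} = T_i − ⟨β_T, X_i⟩, S_n := ∑_{i=1}^n R_{T,i}(R_{Y,i} − θ0 R_{T,i}), and W_n := ⟨β_T − β̂_T, ∑_{i=1}^n X_i (R_{Y,i} − θ0 R_{T,i})⟩. Then for every η > 0, Med-bias_{θ0}(θ̂)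 ≤ max(1/2 − max{P(S_n ≤ −η), P(S_n ≥ η)}, 0) + P(|W_n| > η). -/
open MeasureTheory
open scoped RealInnerProductSpace

/-- A minimizer of `θ ↦ ∑ᵢ (pᵢ - θ qᵢ)²` with `∑ᵢ qᵢ² > 0` satisfies the first-order condition,
centred at an arbitrary point `θ0`. -/
theorem sub_mul_sum_sq_eq_of_forall_sum_sq_le {ι : Type*} [Fintype ι] (p q : ι → ℝ) (t θ0 : ℝ)
    (hpos : 0 < ∑ i, q i ^ 2)
    (hmin : ∀ θ : ℝ, ∑ i, (p i - t * q i) ^ 2 ≤ ∑ i, (p i - θ * q i) ^ 2) :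
    (t - θ0) * ∑ i, q i ^ 2 = ∑ i, q i * (p i - θ0 * q i) := by
  have hquad : ∀ θ : ℝ, ∑ i, (p i - θ * q i) ^ 2 =
      ∑ i, p i ^ 2 - 2 * θ * ∑ i, q i * p i + θ ^ 2 * ∑ i, q i ^ 2 := fun θ => by
    simp only [Finset.mul_sum, ← Finset.sum_sub_distrib, ← Finset.sum_add_distrib]
    exact Finset.sum_congr rfl fun i _ => by ring
  have hlin : ∑ i, q i * (p i - θ0 * q i) = ∑ i, q i * p i - θ0 * ∑ i, q i ^ 2 := by
    simp only [Finset.mul_sum, ← Finset.sum_sub_distrib]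
    exact Finset.sum_congr rfl fun i _ => by ring
  rw [hlin]
  set a := ∑ i, q i ^ 2
  set b := ∑ i, q i * p i
  have h := hmin (b / a)
  rw [hquad, hquad] at h
  have hsq : (t * a - b) ^ 2 ≤ 0 := by
    have h' := mul_le_mul_of_nonneg_right h hpos.le
    field_simp at h'
    nlinarith
  have := pow_eq_zero_iff (two_ne_zero) |>.1 (le_antisymm hsq (sq_nonneg _))
  linarith

/-- If `∑ᵢ (tᵢ - ⟪b, xᵢ⟫) xᵢ = 0`, the inner product of the two fitted residual vectors equals
the corresponding quantity for arbitrary coefficients plus a correction linear in `c - b`. -/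
theorem sum_residual_mul_eq {ι E : Type*} [Fintype ι] [NormedAddCommGroup E]
    [InnerProductSpace ℝ E] (x : ι → E) (y t : ι → ℝ) (a b a' c : E) (θ0 : ℝ)
    (hb : ∑ i, (t i - ⟪b, x i⟫) • x i = 0) :
    ∑ i, (t i - ⟪b, x i⟫) * ((y i - ⟪a, x i⟫) - θ0 * (t i - ⟪b, x i⟫)) =
      ∑ i, (t i - ⟪c, x i⟫) * ((y i - ⟪a', x i⟫) - θ0 * (t i - ⟪c, x i⟫)) +
        ⟪c - b, ∑ i, ((y i - ⟪a', x i⟫) - θ0 * (t i - ⟪c, x i⟫)) • x i⟫ := by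
  have h : ⟪(a' - a) - θ0 • (c - b), ∑ i, (t i - ⟪b, x i⟫) • x i⟫ = 0 := by
    rw [hb, inner_zero_right]
  rw [inner_sum] at h ⊢
  rw [← Finset.sum_add_distrib, ← sub_eq_zero, ← Finset.sum_sub_distrib, ← h]
  refine Finset.sum_congr rfl fun i _ => ?_
  simp only [inner_smul_right, inner_sub_left, real_inner_smul_left]
  ring

/-- If `s` is a.e. contained in `t ∪ u`, then `P(s) ≤ P(t) + P(u)`. -/
theorem toReal_measure_le_add_of_ae_imp {Ω : Type*} [MeasurableSpace Ω] (μ : Measure Ω)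
    [IsFiniteMeasure μ] {s t u : Set Ω} (h : ∀ᵐ ω ∂μ, ω ∈ s → ω ∈ t ∪ u) :
    (μ s).toReal ≤ (μ t).toReal + (μ u).toReal := by
  rw [← ENNReal.toReal_add (measure_ne_top _ _) (measure_ne_top _ _)]
  exact ENNReal.toReal_mono (by simp) ((measure_mono_ae h).trans (measure_union_le _ _))

/-- with `β̂Y, β̂T` satisfying the normal equations almost surely,
residuals `R̂_{Y,i} = Y_i - ⟪β̂Y, X_i⟫` and `R̂_{T,i} = T_i - ⟪β̂T, X_i⟫` with
`∑ᵢ R̂_{T,i}² > 0` a.s., and `θhat` the (a.e.) minimizer of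
`θ ↦ ∑ᵢ (R̂_{Y,i} - θ R̂_{T,i})²`, for fixed `θ0, βY, βT` and
`Sₙ = ∑ᵢ R_{T,i}(R_{Y,i} - θ0 R_{T,i})`,
`Wₙ = ⟪βT - β̂T, ∑ᵢ X_i (R_{Y,i} - θ0 R_{T,i})⟫`, for every `η > 0`,
`Med-bias_{θ0}(θhat) ≤ max (1/2 - max {P(Sₙ ≤ -η), P(Sₙ ≥ η)}) 0 + P(|Wₙ| > η)`. -/
theorem median_bias_stmt14 {Ω : Type*} [MeasurableSpace Ω] (μ : Measure Ω)
    [IsProbabilityMeasure μ] (n d : ℕ)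
    (X : Fin n → Ω → EuclideanSpace ℝ (Fin d)) (Y T : Fin n → Ω → ℝ)
    (hX : ∀ i, Measurable (X i)) (hY : ∀ i, Measurable (Y i)) (hT : ∀ i, Measurable (T i))
    (βhatY βhatT : Ω → EuclideanSpace ℝ (Fin d))
    (hβhatY : Measurable βhatY) (hβhatT : Measurable βhatT)
    (hnormY : ∀ᵐ ω ∂μ, ∑ i, (Y i ω - ⟪βhatY ω, X i ω⟫) • X i ω = 0)
    (hnormT : ∀ᵐ ω ∂μ, ∑ i, (T i ω - ⟪βhatT ω, X i ω⟫) • X i ω = 0)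
    (hpos : ∀ᵐ ω ∂μ, 0 < ∑ i, (T i ω - ⟪βhatT ω, X i ω⟫) ^ 2)
    (θhat : Ω → ℝ) (hθhatmeas : Measurable θhat)
    (hmin : ∀ᵐ ω ∂μ, ∀ θ : ℝ,
      ∑ i, ((Y i ω - ⟪βhatY ω, X i ω⟫) - θhat ω * (T i ω - ⟪βhatT ω, X i ω⟫)) ^ 2 ≤
        ∑ i, ((Y i ω - ⟪βhatY ω, X i ω⟫) - θ * (T i ω - ⟪βhatT ω, X i ω⟫)) ^ 2)
    (θ0 : ℝ) (βY βT : EuclideanSpace ℝ (Fin d))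
    (Sn Wn : Ω → ℝ)
    (hSn : ∀ ω, Sn ω = ∑ i,
      (T i ω - ⟪βT, X i ω⟫) * ((Y i ω - ⟪βY, X i ω⟫) - θ0 * (T i ω - ⟪βT, X i ω⟫)))
    (hWn : ∀ ω, Wn ω =
      ⟪βT - βhatT ω, ∑ i, ((Y i ω - ⟪βY, X i ω⟫) - θ0 * (T i ω - ⟪βT, X i ω⟫)) • X i ω⟫)
    (η : ℝ) (hη : 0 < η) :
    medBias μ θhat θ0 ≤
      max (1 / 2 - max (μ {ω | Sn ω ≤ -η}).toReal (μ {ω | Sn ω ≥ η}).toReal) 0 +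
        (μ {ω | η < |Wn ω|}).toReal := by
  have hkey : ∀ᵐ ω ∂μ,
      (θhat ω - θ0) * ∑ i, (T i ω - ⟪βhatT ω, X i ω⟫) ^ 2 = Sn ω + Wn ω := by
    filter_upwards [hnormT, hpos, hmin] with ω h1 h2 h3
    rw [sub_mul_sum_sq_eq_of_forall_sum_sq_le (fun i => Y i ω - ⟪βhatY ω, X i ω⟫)
      (fun i => T i ω - ⟪βhatT ω, X i ω⟫) _ θ0 h2 h3, hSn, hWn]
    exact sum_residual_mul_eq (fun i => X i ω) (fun i => Y i ω) (fun i => T i ω) _ _ βY βT θ0 h1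
  have hle : (μ {ω | Sn ω ≤ -η}).toReal ≤
      (μ {ω | θhat ω ≤ θ0}).toReal + (μ {ω | η < |Wn ω|}).toReal := by
    refine toReal_measure_le_add_of_ae_imp μ ?_
    filter_upwards [hkey, hpos] with ω hk hp (hS : Sn ω ≤ -η)
    refine or_iff_not_imp_right.2 fun (hW : ¬ η < |Wn ω|) => ?_
    have hW' := abs_le.1 (not_lt.1 hW)
    refine sub_nonpos.1 (nonpos_of_mul_nonpos_left ?_ hp)
    linarith [hW'.2]
  have hge : (μ {ω | Sn ω ≥ η}).toReal ≤
      (μ {ω | θhat ω ≥ θ0}).toReal + (μ {ω | η < |Wn ω|}).toReal := by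
    refine toReal_measure_le_add_of_ae_imp μ ?_
    filter_upwards [hkey, hpos] with ω hk hp (hS : Sn ω ≥ η)
    refine or_iff_not_imp_right.2 fun (hW : ¬ η < |Wn ω|) => ?_
    have hW' := abs_le.1 (not_lt.1 hW)
    refine sub_nonneg.1 (nonneg_of_mul_nonneg_left ?_ hp)
    linarith [hW'.1]
  have hmax := max_le_max hle hge
  rw [max_add_add_right] at hmax
  have hW0 : 0 ≤ (μ {ω | η < |Wn ω|}).toReal := ENNReal.toReal_nonneg
  refine max_le ?_ (add_nonneg (le_max_right _ _) hW0)
  refine le_trans ?_ (add_le_add_left (le_max_left _ _) _)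
  linarith
end
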